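/- Any maximal periodic repeat σ in a word w that is represented by a maximal repetition r is generated by r; that is, beg(fact(σ)) = beg(r), end(fact(σ)) = end(r), and p(σ) is divisible by p(r). -/

import Mathlib

variable {A : Type*}

/-- `p` is a period of the factor `w[i..j]` of the word `w` (positions are 1-based):
`1 ≤ p ≤ j - i + 1` and `w[k] = w[k+p]` whenever both positions lie in `[i, j]`. -/
def IsPeriodOf (w : ℕ → A) (i j p : ℕ) : Prop :=
  1 ≤ p ∧ p ≤ j - i + 1 ∧ ∀ k, i ≤ k → k + p ≤ j → w k = w (k + p)

/-- The minimal period of the factor `w[i..j]`. -/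
noncomputable def minPer (w : ℕ → A) (i j : ℕ) : ℕ :=
  sInf {p | IsPeriodOf w i j p}

/-- The maximality conditions for a factor `w[i..j]` of the word `w` of length `n`,
with respect to its minimal period: it cannot be extended to the left or to the right
by one letter preserving the minimal period. -/
def MaxCond (n : ℕ) (w : ℕ → A) (i j : ℕ) : Prop :=
  (1 < i → w (i - 1) ≠ w (i + minPer w i j - 1)) ∧
  (j < n → w (j + 1) ≠ w (j - minPer w i j + 1))

/-- `w[i..j]` is a maximal repetition (run) in the word `w` of length `n`. -/
def IsMaxRepetition (n : ℕ) (w : ℕ → A) (i j : ℕ) : Prop :=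
  1 ≤ i ∧ i ≤ j ∧ j ≤ n ∧ 2 * minPer w i j ≤ j - i + 1 ∧ MaxCond n w i j

/-- `w[i..j]` is a maximal subrepetition in the word `w` of length `n`:
its exponent is strictly between 1 and 2 and it satisfies the maximality conditions. -/
def IsMaxSubrepetition (n : ℕ) (w : ℕ → A) (i j : ℕ) : Prop :=
  1 ≤ i ∧ i ≤ j ∧ j ≤ n ∧ minPer w i j < j - i + 1 ∧
    j - i + 1 < 2 * minPer w i j ∧ MaxCond n w i j

/-- A repeat in the word `w` of length `n`: a pair of equal factors
`w[b1..e1]` (left copy) and `w[b2..e2]` (right copy) with `b1 < b2`. -/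
structure WordRepeat (n : ℕ) (w : ℕ → A) where
  b1 : ℕ
  e1 : ℕ
  b2 : ℕ
  e2 : ℕ
  one_le_b1 : 1 ≤ b1
  b1_le_e1 : b1 ≤ e1
  b2_le_e2 : b2 ≤ e2
  e2_le_n : e2 ≤ n
  b1_lt_b2 : b1 < b2
  len_eq : e1 - b1 = e2 - b2
  copies_eq : ∀ k, k ≤ e1 - b1 → w (b1 + k) = w (b2 + k)

namespace WordRepeat

variable {n : ℕ} {w : ℕ → A}

/-- The period of the repeat. -/
def p (σ : WordRepeat n w) : ℕ := σ.b2 - σ.b1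

/-- The length of the copies of the repeat. -/
def c (σ : WordRepeat n w) : ℕ := σ.e1 - σ.b1 + 1

/-- The repeat is maximal: its copies cannot be simultaneously extended to the left
or to the right preserving the period. (`fact σ = w[b1..e2]`.) -/
def Maximal (σ : WordRepeat n w) : Prop :=
  (1 < σ.b1 → w (σ.b1 - 1) ≠ w (σ.b2 - 1)) ∧
  (σ.e2 < n → w (σ.e1 + 1) ≠ w (σ.e2 + 1))

/-- The repeat is overlapped: its copies are overlapped factors. -/
def Overlapped (σ : WordRepeat n w) : Prop := σ.b2 ≤ σ.e1 + 1

/-- The repeat is gapped: there is a nonempty gap between its copies. -/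
def Gapped (σ : WordRepeat n w) : Prop := σ.e1 + 1 < σ.b2

/-- The repeat is `α`-gapped: it is gapped and `p(σ) ≤ α ⬝ c(σ)`. -/
def AlphaGapped (α : ℝ) (σ : WordRepeat n w) : Prop :=
  σ.Gapped ∧ (σ.p : ℝ) ≤ α * (σ.c : ℝ)

/-- `σ` is covered by `σ'`: `fact σ = w[σ.b1..σ.e2]` is contained in
`fact σ' = w[σ'.b1..σ'.e2]` and `p(σ') < p(σ)`. -/
def CoveredBy (σ σ' : WordRepeat n w) : Prop :=
  σ'.b1 ≤ σ.b1 ∧ σ.e2 ≤ σ'.e2 ∧ σ'.p < σ.p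

end WordRepeat

/-- `σ` is the principal repeat of some maximal repetition of `w`
(a reprincipal repeat). -/
def IsPrincipalOfMaxRepetition {n : ℕ} {w : ℕ → A} (σ : WordRepeat n w) : Prop :=
  ∃ i j, IsMaxRepetition n w i j ∧ σ.b1 = i ∧ σ.e1 = j - minPer w i j ∧
    σ.b2 = i + minPer w i j ∧ σ.e2 = j

/-- `σ` is principal: it is the principal repeat of some maximal repetition or
maximal subrepetition of `w`. -/
def IsPrincipal {n : ℕ} {w : ℕ → A} (σ : WordRepeat n w) : Prop :=
  ∃ i j, (IsMaxRepetition n w i j ∨ IsMaxSubrepetition n w i j) ∧ σ.b1 = i ∧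
    σ.e1 = j - minPer w i j ∧ σ.b2 = i + minPer w i j ∧ σ.e2 = j

/-- `σ` is a periodic repeat: its copies are repetitions whose minimal period
is at most `c(σ)/3`. -/
def IsPeriodicRepeat {n : ℕ} {w : ℕ → A} (σ : WordRepeat n w) : Prop :=
  3 * minPer w σ.b1 σ.e1 ≤ σ.c

/-- The periodic repeat `σ` is represented by the maximal repetition `w[i..j]`:
both copies of `σ` extend (preserving their minimal period) to `w[i..j]`;
equivalently, `w[i..j]` is a maximal repetition whose minimal period equals the
minimal period of the copies of `σ` and which contains both copies of `σ`. -/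
def RepresentedBy {n : ℕ} {w : ℕ → A} (σ : WordRepeat n w) (i j : ℕ) : Prop :=
  IsPeriodicRepeat σ ∧ IsMaxRepetition n w i j ∧
  minPer w i j = minPer w σ.b1 σ.e1 ∧ i ≤ σ.b1 ∧ σ.e2 ≤ j

/-- The periodic repeat `σ` is represented by the pair of distinct maximal repetitions
`w[i1..j1]`, `w[i2..j2]`: the left copy of `σ` extends to `w[i1..j1]`, the right copy
extends to `w[i2..j2]`, the two repetitions being distinct (`σ` is birepresented). -/
def RepresentedByPair {n : ℕ} {w : ℕ → A} (σ : WordRepeat n w)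
    (i1 j1 i2 j2 : ℕ) : Prop :=
  IsPeriodicRepeat σ ∧ IsMaxRepetition n w i1 j1 ∧ IsMaxRepetition n w i2 j2 ∧
  minPer w i1 j1 = minPer w σ.b1 σ.e1 ∧ minPer w i2 j2 = minPer w σ.b1 σ.e1 ∧
  i1 ≤ σ.b1 ∧ σ.e1 ≤ j1 ∧ i2 ≤ σ.b2 ∧ σ.e2 ≤ j2 ∧ ¬(i1 = i2 ∧ j1 = j2)

/-- The minimal period of a nonempty factor is one of its periods. -/
theorem isPeriodOf_minPer {A : Type*} (w : ℕ → A) {i j : ℕ} (hij : i ≤ j) :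
    IsPeriodOf w i j (minPer w i j) := by
  have hne : {p | IsPeriodOf w i j p}.Nonempty :=
    ⟨j - i + 1, by omega, le_rfl, fun k hk hkj => by omega⟩
  exact Nat.sInf_mem hne

/-- Positions of a factor that differ by a multiple of a period carry the same letter. -/
theorem IsPeriodOf.eq_add_mul {A : Type*} {w : ℕ → A} {i j q : ℕ} (h : IsPeriodOf w i j q)
    {k : ℕ} (hk : i ≤ k) (m : ℕ) (hm : k + q * m ≤ j) : w k = w (k + q * m) := by
  induction m with
  | zero => simp
  | succ m ih =>
    rw [Nat.mul_succ, ← Nat.add_assoc] at hm ⊢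
    exact (ih (by omega)).trans (h.2.2 _ (by omega) hm)

/-- If both copies of a repeat lie in a factor whose period `q` is the minimal period of the
copies, then `q` divides the period of the repeat. -/
theorem WordRepeat.minPer_dvd_p {A : Type*} {n : ℕ} {w : ℕ → A} (σ : WordRepeat n w) {i j : ℕ}
    (h : IsPeriodOf w i j (minPer w σ.b1 σ.e1)) (hi : i ≤ σ.b1) (hj : σ.e2 ≤ j) :
    minPer w σ.b1 σ.e1 ∣ σ.p := by
  obtain ⟨hpos, hle, -⟩ := isPeriodOf_minPer w σ.b1_le_e1
  by_contra hdvd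
  have hs : 0 < σ.p % minPer w σ.b1 σ.e1 :=
    Nat.pos_of_ne_zero fun h0 => hdvd (Nat.dvd_of_mod_eq_zero h0)
  have hlt : σ.p % minPer w σ.b1 σ.e1 < minPer w σ.b1 σ.e1 := Nat.mod_lt _ hpos
  have hdiv := Nat.mod_add_div σ.p (minPer w σ.b1 σ.e1)
  have hp : σ.p = σ.b2 - σ.b1 := rfl
  have h1 := σ.b1_le_e1
  have h2 := σ.b2_le_e2
  have h3 := σ.b1_lt_b2
  have h4 := σ.len_eq
  refine absurd (Nat.sInf_le (m := σ.p % minPer w σ.b1 σ.e1) ?_) (not_le.mpr hlt)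
  refine ⟨hs, by omega, fun k hk hke => ?_⟩
  have hcopy := σ.copies_eq (k - σ.b1) (by omega)
  have hper := h.eq_add_mul (k := k + σ.p % minPer w σ.b1 σ.e1) (by omega)
    (σ.p / minPer w σ.b1 σ.e1) (by omega)
  rw [hper, show k + σ.p % minPer w σ.b1 σ.e1 +
    minPer w σ.b1 σ.e1 * (σ.p / minPer w σ.b1 σ.e1) = σ.b2 + (k - σ.b1) by omega, ← hcopy]
  congr 1
  omega

/-- Any maximal periodic repeat `σ` represented by a maximal repetition `w[i..j]` is
generated by this repetition: `beg (fact σ) = i`, `end (fact σ) = j`, and `p(σ)` is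
divisible by the minimal period of `w[i..j]`. -/
theorem represented_by_repetition_is_generated {A : Type*} (n : ℕ) (w : ℕ → A)
    (σ : WordRepeat n w) (i j : ℕ) (hσ : σ.Maximal)
    (hrep : RepresentedBy σ i j) :
    σ.b1 = i ∧ σ.e2 = j ∧ minPer w i j ∣ σ.p := by
  obtain ⟨-, ⟨hi1, hij, hjn, -, -⟩, hmin, hi, hj⟩ := hrep
  have hper := isPeriodOf_minPer w hij
  have hdvd : minPer w i j ∣ σ.p := by
    rw [hmin] at hper ⊢
    exact σ.minPer_dvd_p hper hi hj
  obtain ⟨m, hm⟩ := id hdvd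
  have hp : σ.p = σ.b2 - σ.b1 := rfl
  have h1 := σ.b1_le_e1
  have h2 := σ.b2_le_e2
  have h3 := σ.b1_lt_b2
  have h4 := σ.len_eq
  refine ⟨?_, ?_, hdvd⟩
  · by_contra hne
    refine hσ.1 (by omega) ?_
    rw [hper.eq_add_mul (k := σ.b1 - 1) (by omega) m (by omega), ← hm]
    congr 1
    omega
  · by_contra hne
    refine hσ.2 (by omega) ?_
    rw [hper.eq_add_mul (k := σ.e1 + 1) (by omega) m (by omega), ← hm]
    congr 1
    omega
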